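/- Let k be a field of characteristic different from 2 and let QF(C₂×C₂, k*) denote the group, under pointwise multiplication, of quadratic forms Q: C₂×C₂ → k*. If k contains an element i with i² = −1, then QF(C₂×C₂, k*) is isomorphic, as a group, to C₄ × C₄ × C₂ (in particular it has exactly 32 elements). If k contains no element i with i² = −1, then QF(C₂×C₂, k*) is isomorphic to C₂ × C₂ × C₂. -/

import Mathlib

/-- The Klein four-group `C₂ × C₂`, written multiplicatively. -/
abbrev K : Type := Multiplicative (ZMod 2 × ZMod 2)

def σ : K := Multiplicative.ofAdd (1, 0)
def τ : K := Multiplicative.ofAdd (0, 1)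
def ρ : K := Multiplicative.ofAdd (1, 1)

/-- A quadratic form on an abelian group `G` with values in `kˣ`. -/
def IsQuadraticForm {k : Type*} [Field k] {G : Type*} [CommGroup G] (Q : G → kˣ) : Prop :=
  (∀ x : G, Q x⁻¹ = Q x) ∧
  ∀ x y z : G, Q (x * y * z) * Q x * Q y * Q z = Q (x * y) * Q (x * z) * Q (y * z)

/-- The group `QF(C₂×C₂, kˣ)` of quadratic forms on the Klein group, under
pointwise multiplication. -/
def QFgrp (k : Type*) [Field k] : Subgroup (K → kˣ) where
  carrier := {Q : K → kˣ | IsQuadraticForm Q}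
  one_mem' := by
    refine ⟨fun x => rfl, fun x y z => ?_⟩
    simp
  mul_mem' := by
    intro a b ha hb
    obtain ⟨ha1, ha2⟩ : IsQuadraticForm a := ha
    obtain ⟨hb1, hb2⟩ : IsQuadraticForm b := hb
    refine ⟨fun x => ?_, fun x y z => ?_⟩
    · simp only [Pi.mul_apply, ha1 x, hb1 x]
    · simp only [Pi.mul_apply]
      simpa only [mul_assoc, mul_left_comm, mul_comm] using
        congrArg₂ (· * ·) (ha2 x y z) (hb2 x y z)
  inv_mem' := by
    intro a ha
    obtain ⟨ha1, ha2⟩ : IsQuadraticForm a := ha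
    refine ⟨fun x => ?_, fun x y z => ?_⟩
    · simp only [Pi.inv_apply, ha1 x]
    · simp only [Pi.inv_apply]
      simpa only [mul_inv, mul_assoc, mul_left_comm, mul_comm] using
        congrArg (·⁻¹) (ha2 x y z)

theorem K_cases : ∀ x : K, x = 1 ∨ x = σ ∨ x = τ ∨ x = ρ := by decide

theorem isQF_of {k : Type*} [Field k] (Q : K → kˣ) (h1 : Q 1 = 1)
    (hs : Q σ ^ 4 = 1) (ht : Q τ ^ 4 = 1) (hr : Q ρ ^ 2 = Q σ ^ 2 * Q τ ^ 2) :
    IsQuadraticForm Q := by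
  have inv : ∀ x : K, x⁻¹ = x := by decide
  have m1 : σ * σ = 1 := by decide
  have m2 : τ * τ = 1 := by decide
  have m3 : ρ * ρ = 1 := by decide
  have m4 : σ * τ = ρ := by decide
  have m5 : τ * σ = ρ := by decide
  have m6 : σ * ρ = τ := by decide
  have m7 : ρ * σ = τ := by decide
  have m8 : τ * ρ = σ := by decide
  have m9 : ρ * τ = σ := by decide
  refine ⟨fun x => by rw [inv], fun x y z => ?_⟩
  generalize hS : Q σ = s at *
  generalize hT : Q τ = t at *
  generalize hR : Q ρ = r at *
  have hs' := congrArg Units.val hs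
  have ht' := congrArg Units.val ht
  have hr' := congrArg Units.val hr
  push_cast at hs' ht' hr'
  rcases K_cases x with rfl | rfl | rfl | rfl <;>
  rcases K_cases y with rfl | rfl | rfl | rfl <;>
  rcases K_cases z with rfl | rfl | rfl | rfl <;>
  simp only [m1, m2, m3, m4, m5, m6, m7, m8, m9, one_mul, mul_one, h1, hS, hT, hR] <;>
  (apply Units.ext; push_cast; grind)

theorem QF_props {k : Type*} [Field k] (Q : K → kˣ) (h : IsQuadraticForm Q) :
    Q 1 = 1 ∧ Q σ ^ 4 = 1 ∧ Q τ ^ 4 = 1 ∧ Q ρ ^ 2 = Q σ ^ 2 * Q τ ^ 2 := by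
  have m1 : σ * σ = 1 := by decide
  have m2 : τ * τ = 1 := by decide
  have m4 : σ * τ = ρ := by decide
  obtain ⟨-, h⟩ := h
  have e1 : Q 1 = 1 := by simpa using h 1 1 1
  have e2 := h σ σ σ
  have e3 := h τ τ τ
  have e4 := h σ σ τ
  simp only [m1, m2, m4, one_mul, e1] at e2 e3 e4
  refine ⟨e1, ?_, ?_, ?_⟩
  · simpa only [pow_succ, pow_zero, one_mul] using e2
  · simpa only [pow_succ, pow_zero, one_mul] using e3
  · rw [pow_two, ← e4, pow_two, pow_two]; ac_rfl

theorem QF_equiv (k : Type*) [Field k] :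
    Nonempty (QFgrp k ≃* rootsOfUnity 4 k × rootsOfUnity 4 k × rootsOfUnity 2 k) := by
  let f : QFgrp k →* rootsOfUnity 4 k × rootsOfUnity 4 k × rootsOfUnity 2 k :=
    { toFun := fun Q => (⟨Q.1 σ, (QF_props Q.1 Q.2).2.1⟩, ⟨Q.1 τ, (QF_props Q.1 Q.2).2.2.1⟩,
        ⟨Q.1 ρ * (Q.1 σ * Q.1 τ)⁻¹, by
          rw [mem_rootsOfUnity, mul_pow, inv_pow, mul_pow, (QF_props Q.1 Q.2).2.2.2]
          exact mul_inv_cancel _⟩)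
      map_one' := by
        refine Prod.ext (Subtype.ext ?_) (Prod.ext (Subtype.ext ?_) (Subtype.ext ?_)) <;> simp
      map_mul' := by
        intro P Q
        refine Prod.ext (Subtype.ext ?_) (Prod.ext (Subtype.ext ?_) (Subtype.ext ?_))
        · simp
        · simp
        · simp only [Subgroup.coe_mul, Pi.mul_apply, mul_inv, Prod.snd_mul]
          ac_rfl }
  refine ⟨MulEquiv.ofBijective f ⟨?_, ?_⟩⟩
  · intro P Q h
    have hs : P.1 σ = Q.1 σ := congrArg (fun z => (z.1 : kˣ)) h
    have ht : P.1 τ = Q.1 τ := congrArg (fun z => (z.2.1 : kˣ)) h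
    have hr : P.1 ρ * (P.1 σ * P.1 τ)⁻¹ = Q.1 ρ * (Q.1 σ * Q.1 τ)⁻¹ :=
      congrArg (fun z => (z.2.2 : kˣ)) h
    rw [hs, ht] at hr
    have hr := mul_right_cancel hr
    refine Subtype.ext (funext fun x => ?_)
    rcases K_cases x with rfl | rfl | rfl | rfl
    · rw [(QF_props P.1 P.2).1, (QF_props Q.1 Q.2).1]
    · exact hs
    · exact ht
    · exact hr
  · rintro ⟨⟨s, hs⟩, ⟨t, ht⟩, ⟨u, hu⟩⟩
    rw [mem_rootsOfUnity] at hs ht hu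
    have n1 : σ ≠ 1 := by decide
    have n2 : τ ≠ 1 := by decide
    have n3 : ρ ≠ 1 := by decide
    have n4 : τ ≠ σ := by decide
    have n5 : ρ ≠ σ := by decide
    have n6 : ρ ≠ τ := by decide
    let Q : K → kˣ := fun x => if x = 1 then 1 else if x = σ then s else if x = τ then t
      else u * (s * t)
    have q1 : Q 1 = 1 := by simp [Q]
    have q2 : Q σ = s := by simp [Q, n1]
    have q3 : Q τ = t := by simp [Q, n2, n4]
    have q4 : Q ρ = u * (s * t) := by simp [Q, n3, n5, n6]
    have hQ : IsQuadraticForm Q := by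
      apply isQF_of Q q1
      · rw [q2, hs]
      · rw [q3, ht]
      · rw [q2, q3, q4, mul_pow, hu, one_mul, mul_pow]
    refine ⟨⟨Q, hQ⟩, ?_⟩
    refine Prod.ext (Subtype.ext q2) (Prod.ext (Subtype.ext q3) (Subtype.ext ?_))
    change Q ρ * (Q σ * Q τ)⁻¹ = u
    rw [q2, q3, q4, mul_inv_cancel_right]

theorem roots_equiv {k : Type*} [Field k] (n : ℕ) [NeZero n] (ζ : k) (h : IsPrimitiveRoot ζ n) :
    Nonempty (rootsOfUnity n k ≃* Multiplicative (ZMod n)) := by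
  refine ⟨mulEquivOfCyclicCardEq ?_⟩
  rw [h.card_rootsOfUnity]
  simp

theorem statement18 (k : Type*) [Field k] (hk : ringChar k ≠ 2) :
    ((∃ i : k, i ^ 2 = -1) →
      Nonempty (QFgrp k ≃*
        Multiplicative (ZMod 4) × Multiplicative (ZMod 4) × Multiplicative (ZMod 2)) ∧
      Nat.card (QFgrp k) = 32) ∧
    ((¬ ∃ i : k, i ^ 2 = -1) →
      Nonempty (QFgrp k ≃*
        Multiplicative (ZMod 2) × Multiplicative (ZMod 2) × Multiplicative (ZMod 2))) := by
  have h2 : (2 : k) ≠ 0 := Ring.two_ne_zero hk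
  have hne : (-1 : k) ≠ 1 := Ring.neg_one_ne_one_of_char_ne_two hk
  obtain ⟨e⟩ := QF_equiv k
  obtain ⟨e2⟩ := roots_equiv 2 (-1 : k) (IsPrimitiveRoot.neg_one (ringChar k) hk)
  refine ⟨?_, ?_⟩
  · rintro ⟨i, hi⟩
    have hp : IsPrimitiveRoot i (2 ^ (1 + 1)) := by
      rw [IsPrimitiveRoot.iff_orderOf]
      apply orderOf_eq_prime_pow
      · rw [pow_one, hi]; exact hne
      · rw [pow_succ, pow_one, pow_mul, hi]; norm_num
    obtain ⟨e4⟩ := roots_equiv 4 i hp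
    let E := e.trans (e4.prodCongr (e4.prodCongr e2))
    refine ⟨⟨E⟩, ?_⟩
    rw [Nat.card_congr E.toEquiv]
    simp [Nat.card_prod]
  · intro hi
    have heq : rootsOfUnity 4 k = rootsOfUnity 2 k := by
      ext u
      rw [mem_rootsOfUnity', mem_rootsOfUnity']
      constructor
      · intro h
        have h' : ((u : k) ^ 2 - 1) * ((u : k) ^ 2 + 1) = 0 := by linear_combination h
        rcases mul_eq_zero.mp h' with h | h
        · exact sub_eq_zero.mp h
        · exact absurd ⟨(u : k), eq_neg_of_add_eq_zero_left h⟩ hi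
      · intro h
        linear_combination ((u : k) ^ 2 + 1) * h
    let e4 := (MulEquiv.subgroupCongr heq).trans e2
    exact ⟨e.trans (e4.prodCongr (e4.prodCongr e2))⟩
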